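/- arXiv:2012.08704 — 3 statements merged into one kernel-verified Lean document; each statement's English description precedes it below -/
import Mathlib

section
/- Let g > 0 and define U : ℝ → ℝ by U(d) = 0.48·g − √((0.48·g)² + 0.8·g·d) and U'(d) = −0.4·g / √((0.48·g)² + 0.8·g·d). Let ε > 0, d₀ ≥ 0, and let (d, v) ∈ ℝ² with d ≥ 0. If v ≤ −ε and v ≤ U'(d₀)·(d − d₀) + U(d₀) − ε, then the red-light condition holds at (d, v): v < 0 and d ≤ −1.2·v + v²/(0.8·g). (Proposition 1: the surrogate constraints are tighter than the red-light condition.) -/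
/-- Proposition 1: the surrogate constraints are tighter than the red-light condition. -/
theorem surrogate_red_tighter (g ε d₀ d v : ℝ)
    (hg : 0 < g) (hε : 0 < ε) (hd₀ : 0 ≤ d₀) (hd : 0 ≤ d)
    (U : ℝ → ℝ) (hU : ∀ x, U x = 0.48 * g - Real.sqrt ((0.48 * g) ^ 2 + 0.8 * g * x))
    (U' : ℝ → ℝ) (hU' : ∀ x, U' x = -0.4 * g / Real.sqrt ((0.48 * g) ^ 2 + 0.8 * g * x))
    (h1 : v ≤ -ε)
    (h2 : v ≤ U' d₀ * (d - d₀) + U d₀ - ε) :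
    v < 0 ∧ d ≤ -1.2 * v + v ^ 2 / (0.8 * g) := by
  refine ⟨by linarith, ?_⟩
  rw [hU, hU'] at h2
  have hA : 0 < (0.48 * g) ^ 2 + 0.8 * g * d₀ := by positivity
  have hs := Real.sqrt_pos.mpr hA
  have hsq := Real.sq_sqrt hA.le
  set s := Real.sqrt ((0.48 * g) ^ 2 + 0.8 * g * d₀)
  have htangent : 0.4 * g * (d - d₀) / s ≤ 0.48 * g - v - s := by
    have : -0.4 * g / s * (d - d₀) = -(0.4 * g * (d - d₀) / s) := by ring
    linarith
  rw [div_le_iff₀ hs] at htangent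
  have hquad : 0.8 * g * d ≤ v ^ 2 - 0.96 * g * v := by
    nlinarith [sq_nonneg (0.48 * g - v - s)]
  have hdiv : d + 1.2 * v ≤ v ^ 2 / (0.8 * g) := by
    rw [le_div_iff₀ (by positivity)]
    linarith
  linarith
end

section
/- Let g > 0 and define U : ℝ → ℝ by U(d) = 0.48·g − √((0.48·g)² + 0.8·g·d). Then for all v < 0 and d ≥ 0: d ≤ −1.2·v + v²/(0.8·g) if and only if v ≤ U(d). (For negative velocities, the red-light distance condition is equivalent to the velocity lying below the curve U.) -/
/-- For negative velocities, the red-light distance condition is equivalent to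
the velocity lying below the curve U. -/
theorem red_distance_iff_below_U (g : ℝ) (hg : 0 < g)
    (U : ℝ → ℝ) (hU : ∀ x, U x = 0.48 * g - Real.sqrt ((0.48 * g) ^ 2 + 0.8 * g * x))
    (v d : ℝ) (hv : v < 0) (hd : 0 ≤ d) :
    d ≤ -1.2 * v + v ^ 2 / (0.8 * g) ↔ v ≤ U d := by
  have hc : 0 < 0.8 * g := by positivity
  have hs : 0 ≤ 0.48 * g - v := by linarith
  rw [hU, le_sub_comm, Real.sqrt_le_left hs, ← sub_le_iff_le_add', le_div_iff₀ hc]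
  constructor <;> intro h <;> linarith
end

section
/- Let g > 0 and define U : ℝ → ℝ by U(d) = 0.48·g − √((0.48·g)² + 0.8·g·d). Let ε > 0 and d₀ > 0, and let (d, v) ∈ ℝ² with 0 ≤ d ≤ d₀. If v ≤ −ε and v ≥ (U(d₀)/d₀)·d + ε, then the yellow-light condition holds at (d, v): v < 0 and d > −1.2·v + v²/(0.8·g). (The surrogate constraints for the yellow light are tighter than the yellow-light condition.) -/
/-- The surrogate constraints for the yellow light are tighter than the
yellow-light condition. -/
theorem surrogate_yellow_tighter (g ε d₀ d v : ℝ)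
    (hg : 0 < g) (hε : 0 < ε) (hd₀ : 0 < d₀) (hd : 0 ≤ d) (hdd₀ : d ≤ d₀)
    (U : ℝ → ℝ) (hU : ∀ x, U x = 0.48 * g - Real.sqrt ((0.48 * g) ^ 2 + 0.8 * g * x))
    (h1 : v ≤ -ε)
    (h2 : v ≥ (U d₀ / d₀) * d + ε) :
    v < 0 ∧ d > -1.2 * v + v ^ 2 / (0.8 * g) := by
  have hv : v < 0 := by linarith
  refine ⟨hv, ?_⟩
  set u := -U d₀ with hu
  set t := d / d₀ with ht
  have ht0 : 0 ≤ t := div_nonneg hd hd₀.le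
  have ht1 : t ≤ 1 := (div_le_one hd₀).2 hdd₀
  have htd : d = t * d₀ := by rw [ht]; field_simp
  have hquad : u ^ 2 + 0.96 * g * u = 0.8 * g * d₀ := by
    have hs := Real.sq_sqrt (show 0 ≤ (0.48 * g) ^ 2 + 0.8 * g * d₀ by positivity)
    rw [hu, hU]
    linear_combination hs
  have hslope : U d₀ / d₀ * d = -(u * t) := by rw [hu, ht]; ring
  have hvu : -v < u * t := by rw [hslope] at h2; linarith
  have hsq : v ^ 2 < (u * t) ^ 2 := by nlinarith
  have htu : (u * t) ^ 2 ≤ t * u ^ 2 := by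
    nlinarith [mul_nonneg (mul_nonneg ht0 (sub_nonneg.2 ht1)) (sq_nonneg u)]
  have hlin : 0.96 * g * -v < 0.96 * g * (u * t) :=
    mul_lt_mul_of_pos_left hvu (by positivity)
  have hdt : 0.8 * g * d = t * u ^ 2 + 0.96 * g * (u * t) := by
    rw [htd]
    linear_combination -t * hquad
  have hdiv : v ^ 2 / (0.8 * g) < d + 1.2 * v := by
    rw [div_lt_iff₀ (by positivity)]
    linarith
  linarith
end
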